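/- arXiv:1201.2686 — 8 statements merged into one kernel-verified Lean document; each statement's English description precedes it below -/
import Mathlib

section
/- Every Picard groupoid is equivalent, as a symmetric monoidal category, to one which is both skeletal and permutative. Precisely: for every Picard groupoid C there exists a category D equipped with a symmetric monoidal structure such that (i) D is skeletal (any two isomorphic objects of D are equal), (ii) D is strict: for all objects X, Y, Z of D one has (X ⊗ Y) ⊗ Z = X ⊗ (Y ⊗ Z), I ⊗ X = X and X ⊗ I = X, and the associator and the left and right unitors are the canonical isomorphisms (eqToIso) induced by these object equalities, and (iii) there is an equivalence of categories C ≃ D whose underlying functor is a braided (hence symmetric) monoidal functor. -/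
open CategoryTheory MonoidalCategory

universe v u

/-- A skeletal, permutative (strict) symmetric monoidal model of a symmetric
monoidal groupoid `C`: a skeletal symmetric monoidal category `D` which is
strict (the tensor is associative and unital on the nose, with the associator
and unitors given by the canonical isomorphisms coming from these equalities of
objects), together with an equivalence `C ≌ D` whose underlying functor is a
braided (hence symmetric) monoidal functor. -/
structure SkeletalPermutativeModel (C : Type u) [Groupoid.{v} C] [MonoidalCategory C]
    [SymmetricCategory C] where
  /-- the underlying type of the model -/
  D : Type u
  [cat : Category.{v} D]
  [mon : MonoidalCategory D]
  [symm : SymmetricCategory D]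
  /-- `D` is skeletal: isomorphic objects are equal -/
  skeletal : Skeletal D
  /-- the tensor product is strictly associative -/
  tensor_assoc : ∀ X Y Z : D, (X ⊗ Y) ⊗ Z = X ⊗ (Y ⊗ Z)
  /-- the tensor product is strictly left unital -/
  unit_tensor : ∀ X : D, 𝟙_ D ⊗ X = X
  /-- the tensor product is strictly right unital -/
  tensor_unit : ∀ X : D, X ⊗ 𝟙_ D = X
  /-- the associator is the canonical isomorphism -/
  associator_eq : ∀ X Y Z : D, α_ X Y Z = eqToIso (tensor_assoc X Y Z)
  /-- the left unitor is the canonical isomorphism -/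
  leftUnitor_eq : ∀ X : D, λ_ X = eqToIso (unit_tensor X)
  /-- the right unitor is the canonical isomorphism -/
  rightUnitor_eq : ∀ X : D, ρ_ X = eqToIso (tensor_unit X)
  /-- an equivalence of categories `C ≌ D` -/
  equiv : C ≌ D
  /-- whose underlying functor is braided monoidal -/
  braided : equiv.functor.Braided

section SymmetricCocycles

variable {A M : Type*} [AddCommGroup A] [AddCommGroup M]

/-- The coboundary of a 2-cochain of `A` with values in `M` (trivial action). -/
def cobound (k : A → A → M) (x y z : A) : M :=
  k y z - k (x + y) z + k x (y + z) - k x y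

/-- Symmetric 3-cocycles: the associator and braiding data of a skeletal Picard groupoid. -/
structure IsSymmCocycle (h : A → A → A → M) (c : A → A → M) : Prop where
  pentagon : ∀ x y z w,
    h y z w - h (x + y) z w + h x (y + z) w - h x y (z + w) + h x y z = 0
  hexagon : ∀ x y z, h x y z + h y z x - h y x z = c x (y + z) - c x y - c x z
  symm : ∀ x y, c x y + c y x = 0

/-- `k` exhibits the restriction of `(h, c)` to `B` as a symmetric coboundary. -/
structure Trivializes (k : A → A → M) (h : A → A → A → M) (c : A → A → M) (B : AddSubgroup A) :
    Prop where
  assoc : ∀ x ∈ B, ∀ y ∈ B, ∀ z ∈ B, h x y z = cobound k x y z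
  comm : ∀ x ∈ B, ∀ y ∈ B, c x y = k x y - k y x

theorem exists_int_primitive (m : M) (g : ℤ → M) :
    ∃ F : ℤ → M, F 0 = m ∧ ∀ n, F (n + 1) = F n + g n := by
  refine ⟨fun n => Int.inductionOn' (motive := fun _ => M) n 0 m (fun k _ f => f + g k)
    (fun k _ f => f - g (k - 1)), Int.inductionOn'_self, fun n => ?_⟩
  rcases le_or_gt 0 n with hn | hn
  · exact Int.inductionOn'_add_one hn
  · have := Int.inductionOn'_sub_one (motive := fun _ => M) (b := 0) (zero := m)
      (succ := fun k _ f => f + g k) (pred := fun k _ f => f - g (k - 1)) (z := n + 1) (by omega)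
    have e : n + 1 - 1 = n := by ring
    rw [e] at this
    beta_reduce
    rw [this]
    abel

omit [AddCommGroup M] in
theorem eq_apply_zero_of_add_one {F : ℤ → M} (hF : ∀ n, F (n + 1) = F n) (n : ℤ) : F n = F 0 := by
  induction n with
  | zero => rfl
  | succ n ih => rw [hF, ih]
  | pred n ih => rw [← ih, ← hF (-n - 1)]; congr 1; ring

namespace IsSymmCocycle

variable {h : A → A → A → M} {c : A → A → M}

theorem sub_cobound (H : IsSymmCocycle h c) (k : A → A → M) :
    IsSymmCocycle (fun x y z => h x y z - cobound k x y z)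
      (fun x y => c x y - (k x y - k y x)) where
  pentagon x y z w := by
    have := H.pentagon x y z w
    simp only [cobound, add_assoc] at this ⊢
    rw [← sub_eq_zero.2 this]
    abel
  hexagon x y z := by
    have := H.hexagon x y z
    simp only [cobound]
    rw [add_comm z x, add_comm y x]
    rw [← sub_eq_zero] at this ⊢
    rw [← this]
    abel
  symm x y := by
    rw [← H.symm x y]
    abel

theorem comap {P : Type*} [AddCommGroup P] (H : IsSymmCocycle h c) (p : P →+ A) :
    IsSymmCocycle (fun x y z => h (p x) (p y) (p z)) (fun x y => c (p x) (p y)) where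
  pentagon x y z w := by simpa using H.pentagon (p x) (p y) (p z) (p w)
  hexagon x y z := by simpa using H.hexagon (p x) (p y) (p z)
  symm x y := H.symm _ _

theorem self_add (H : IsSymmCocycle h c) (x y : A) :
    c (x + y) (x + y) = c x x + c y y := by
  have h1 := H.hexagon (x + y) x y
  have h2 := H.hexagon x x y
  have h3 := H.hexagon y x y
  have h4 := H.pentagon x y x y
  have s1 := H.symm (x + y) x
  have s2 := H.symm (x + y) y
  have s3 := H.symm x x
  have s4 := H.symm y y
  have s5 := H.symm x y
  rw [add_comm y x] at h4
  linear_combination (norm := module) -h1 + s1 + s2 + h2 + h3 - s5 - s3 - s4 - h4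

/-- A symmetric cocycle on `B × ℤ` vanishes once it does so on enough elements. -/
theorem eq_zero_of_prod_int {B : Type*} [AddCommGroup B] {h : B × ℤ → B × ℤ → B × ℤ → M}
    {c : B × ℤ → B × ℤ → M} (H : IsSymmCocycle h c) (h1 : ∀ x y, h x y (0, 1) = 0)
    (hB : ∀ b b' b'' : B, h (b, 0) (b', 0) (b'', 0) = 0) (cB : ∀ x b, c x (b, 0) = 0)
    (c1 : c (0, 1) (0, 1) = 0) : (∀ x y z, h x y z = 0) ∧ ∀ x y, c x y = 0 := by
  have step (b : B) (n : ℤ) : ((b, n + 1) : B × ℤ) = (b, n) + (0, 1) := by simp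
  have cB' (b : B) (x) : c (b, 0) x = 0 := by simpa [cB] using H.symm x (b, 0)
  have third (x y : B × ℤ) (b : B) (n : ℤ) : h x y (b, n) = h x y (b, 0) := by
    refine eq_apply_zero_of_add_one (F := fun n => h x y (b, n)) (fun n => ?_) n
    have := H.pentagon x y (b, n) (0, 1)
    simp only [h1] at this
    rw [step]
    grind
  have hmid (y : B × ℤ) (b : B) : h y (0, 1) (b, 0) = 0 := by
    have := H.hexagon (b, 0) y (0, 1)
    simpa [h1, cB'] using this
  have second (x : B × ℤ) (b b' : B) (n : ℤ) : h x (b, n) (b', 0) = h x (b, 0) (b', 0) := by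
    refine eq_apply_zero_of_add_one (F := fun n => h x (b, n) (b', 0)) (fun n => ?_) n
    have := H.pentagon x (b, n) (0, 1) (b', 0)
    have e : ((0, 1) + (b', 0) : B × ℤ) = (b', 1) := by simp
    rw [e, third _ _ b' 1, hmid, hmid, h1] at this
    rw [step]
    grind
  have hz (x y z) : h x y z = 0 := by
    obtain ⟨b, n⟩ := y
    obtain ⟨b', n'⟩ := z
    rw [third, second]
    have := H.hexagon x (b, 0) (b', 0)
    have e : ((b, 0) + (b', 0) : B × ℤ) = (b + b', 0) := by simp
    rw [e, cB, cB, cB] at this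
    obtain ⟨a, m⟩ := x
    rw [third (b, 0) (b', 0), second (b, 0) a b', hB, hB] at this
    simpa using this
  refine ⟨hz, ?_⟩
  have cadd (x y z) : c x (y + z) = c x y + c x z := by
    have := H.hexagon x y z
    simp only [hz] at this
    grind
  have ca (x) : c x (0, 1) = 0 := by
    obtain ⟨b, n⟩ := x
    have : c (0, 1) (b, n) = 0 := by
      rw [← cB (0, 1) b]
      refine eq_apply_zero_of_add_one (F := fun n => c (0, 1) (b, n)) (fun n => ?_) n
      rw [step, cadd, c1, add_zero]
    simpa [this] using H.symm (0, 1) (b, n)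
  rintro x ⟨b, n⟩
  rw [← cB x b]
  refine eq_apply_zero_of_add_one (F := fun n => c x (b, n)) (fun n => ?_) n
  rw [step, cadd, ca, add_zero]

theorem exists_trivialization_prod_int {B : Type*} [AddCommGroup B]
    {h : B × ℤ → B × ℤ → B × ℤ → M} {c : B × ℤ → B × ℤ → M} (H : IsSymmCocycle h c)
    (hself : ∀ x, c x x = 0) (h0 : ∀ x y, h x 0 y = 0) (h0' : ∀ x y, h 0 x y = 0)
    (hc0 : ∀ x, c x 0 = 0)
    (hB : ∀ b b' b'' : B, h (b, 0) (b', 0) (b'', 0) = 0) (cB : ∀ b b' : B, c (b, 0) (b', 0) = 0) :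
    ∃ k : B × ℤ → B × ℤ → M, (∀ x y z, h x y z = cobound k x y z) ∧
      (∀ x y, c x y = k x y - k y x) ∧ ∀ b b' : B, k (b, 0) (b', 0) = 0 := by
  have step (b : B) (n : ℤ) : ((b, n) : B × ℤ) + (0, 1) = (b, n + 1) := by simp
  choose F hF0 hF1 using fun b b' : B =>
    exists_int_primitive 0 fun n => h (b, 0) (b', n) (0, 1)
  choose K hK0 hK1 using fun (x : B × ℤ) (b : B) =>
    exists_int_primitive (F b x.1 x.2 + c x (b, 0)) fun n => h x (b, n) (0, 1)
  have hFK (b b' : B) (n : ℤ) : K (b, 0) b' n = F b b' n := by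
    have := eq_apply_zero_of_add_one (F := fun n => K (b, 0) b' n - F b b' n)
      (fun n => by simp [hF1, hK1]) n
    rw [← sub_eq_zero, this, hK0, hF0, hF0, cB]
    simp
  have hF00 (b : B) (n : ℤ) : F 0 b n = 0 := by
    rw [← hF0 0 b]
    refine eq_apply_zero_of_add_one (fun n => ?_) n
    rw [hF1, ← Prod.zero_eq_mk, h0', add_zero]
  have hKa (x : B × ℤ) : K x 0 1 = 0 := by
    have := hK1 x 0 0
    rw [hK0, ← Prod.zero_eq_mk, h0, hc0, hF00] at this
    simpa using this
  have hKB (b b' : B) : K (b, 0) b' 0 = 0 := by rw [hFK, hF0]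
  let k : B × ℤ → B × ℤ → M := fun x y => K x y.1 y.2
  obtain ⟨e1, e2⟩ := (H.sub_cobound k).eq_zero_of_prod_int
    (fun x y => by
      obtain ⟨b, n⟩ := y
      simp only [cobound, k, step, hKa, hK1]
      abel)
    (fun b b' b'' => by simp [cobound, k, hKB, hB])
    (fun x b => by
      simp only [k, hFK, hK0]
      abel)
    (by simp [hself])
  exact ⟨k, fun x y z => sub_eq_zero.1 (e1 x y z), fun x y => sub_eq_zero.1 (e2 x y), hKB⟩

end IsSymmCocycle

theorem exists_splitting_of_int {R : Type*} [AddCommGroup R] (f : R →+ ℤ)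
    (hf : Function.Injective f) (k : R → R → M) (hk : ∀ x y z, cobound k x y z = 0)
    (hsymm : ∀ x y, k x y = k y x) (h0 : k 0 0 = 0) :
    ∃ l : R → M, l 0 = 0 ∧ ∀ x y, k x y = l x + l y - l (x + y) := by
  have : IsAddCyclic R := isAddCyclic_of_injective f hf
  obtain ⟨g, hg⟩ := IsAddCyclic.exists_generator (α := R)
  simp only [AddSubgroup.mem_zmultiples_iff] at hg
  have h0' (x) : k x 0 = 0 := by
    have := hk x 0 0
    simpa [cobound, h0] using this
  by_cases hfg : f g = 0
  · have hg0 : g = 0 := hf (by simpa using hfg)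
    have (x : R) : x = 0 := by
      obtain ⟨n, rfl⟩ := hg x
      simp [hg0]
    exact ⟨0, rfl, fun x y => by simp [this x, this y, h0]⟩
  · obtain ⟨L, hL0, hL1⟩ := exists_int_primitive (0 : M) fun n => - k (n • g) g
    have hfn (n : ℤ) : f (n • g) / f g = n := by simp [hfg]
    let l : R → M := fun x => L (f x / f g)
    have hl (n : ℤ) : l (n • g) = L n := by simp only [l, hfn]
    have hl0 : l 0 = 0 := by simp [l, hL0]
    have hlg : l g = 0 := by
      have := hl 1
      have h1 := hL1 0
      simp only [zero_add, zero_smul, hL0] at h1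
      have e : k 0 g = 0 := by rw [hsymm, h0']
      rw [one_smul] at this
      rw [this, h1, e, neg_zero]
    refine ⟨l, hl0, fun x y => ?_⟩
    obtain ⟨n, rfl⟩ := hg y
    rw [← sub_eq_zero]
    have := eq_apply_zero_of_add_one
      (F := fun n => k x (n • g) - (l x + l (n • g) - l (x + n • g))) (fun n => ?_) n
    · rw [this]
      simp [h0', hl0]
    · obtain ⟨m, rfl⟩ := hg x
      have e := hk (m • g) (n • g) g
      simp only [cobound] at e
      rw [← add_smul] at e
      have e3 : n • g + g = (n + 1) • g := by simp only [add_smul, one_smul]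
      have e1 := hL1 n
      have e1' := hL1 (m + n)
      rw [e3] at e
      simp only [← add_smul, ← add_assoc, hl, e1, e1']
      linear_combination (norm := module) e

theorem exists_descent {P : Type*} [AddCommGroup P] {h : A → A → A → M} {c : A → A → M}
    (p : P →+ A) (h0 : ∀ x y, h x y 0 = 0) (c0 : ∀ x, c 0 x = 0)
    {k : P → P → M} (hk : ∀ x y z, h (p x) (p y) (p z) = cobound k x y z)
    (hck : ∀ x y, c (p x) (p y) = k x y - k y x) (hk0 : k 0 0 = 0)
    (f : P →+ ℤ) (hf : ∀ x, p x = 0 → f x = 0 → x = 0)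
    (S : AddSubgroup P) (hS : Set.InjOn p S) (hkS : ∀ x ∈ S, ∀ y ∈ S, k x y = 0) :
    ∃ k' : A → A → M, Trivializes k' h c p.range ∧
      ∀ x ∈ S, ∀ y ∈ S, k' (p x) (p y) = 0 := by
  have hk_zero (x) : k x 0 = 0 := by
    have := hk x 0 0
    simpa [cobound, hk0, h0] using this
  have hk_zero' (x) : k 0 x = 0 := by
    have := hck 0 x
    simpa [c0, hk_zero] using this.symm
  obtain ⟨l₀, hl00, hl₀⟩ := exists_splitting_of_int (R := p.ker) (f.comp p.ker.subtype)
    (by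
      rw [injective_iff_map_eq_zero]
      rintro ⟨x, hx⟩ hfx
      exact Subtype.ext (hf x hx hfx))
    (fun x y => k x y)
    (fun x y z => by
      have := hk x y z
      rw [show p z = 0 from z.2, h0] at this
      exact this.symm)
    (fun x y => by
      have := hck x y
      rw [show p x = 0 from x.2, c0] at this
      exact (sub_eq_zero.1 this.symm)) hk0
  have hσ : ∃ σ : A → P, (∀ x, p (σ (p x)) = p x) ∧ ∀ x ∈ S, σ (p x) = x := by
    classical
    refine ⟨fun a => if ha : ∃ x ∈ S, p x = a then ha.choose else
      if ha : ∃ x, p x = a then ha.choose else 0, fun x => ?_, fun x hx => ?_⟩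
    · by_cases ha : ∃ y ∈ S, p y = p x
      · simpa only [dif_pos ha] using ha.choose_spec.2
      · have ha' : ∃ y, p y = p x := ⟨x, rfl⟩
        simpa only [dif_neg ha, dif_pos ha'] using ha'.choose_spec
    · have ha : ∃ y ∈ S, p y = p x := ⟨x, hx, rfl⟩
      simp only [dif_pos ha]
      exact hS ha.choose_spec.1 hx ha.choose_spec.2
  obtain ⟨σ, hσ, hσS⟩ := hσ
  let s (x : P) : p.ker := ⟨x - σ (p x), by simp [AddMonoidHom.mem_ker, hσ]⟩
  have hs (x) : x = σ (p x) + s x := by simp [s]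
  let l (x : P) : M := l₀ (s x) - k (σ (p x)) (s x)
  let k₁ (x y : P) : M := k x y - (l x + l y - l (x + y))
  have hσ0 : σ 0 = 0 := by simpa using hσS 0 S.zero_mem
  have hlS : ∀ x ∈ S, l x = 0 := fun x hx => by
    have : s x = 0 := Subtype.ext (by simp [s, hσS x hx])
    simp [l, this, hl00, hk_zero]
  have hk₁ (x y z) : h (p x) (p y) (p z) = cobound k₁ x y z := by
    rw [hk]
    simp only [cobound, k₁, add_assoc]
    abel
  have hck₁ (x y) : c (p x) (p y) = k₁ x y - k₁ y x := by
    rw [hck]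
    simp only [k₁, add_comm y x]
    abel
  have hR (x : P) (r : p.ker) : k₁ x r = 0 := by
    have hr : p r = 0 := r.2
    have e1 : s (x + r) = s x + r := Subtype.ext (by simp [s, hr]; abel)
    have e2 : s r = r := Subtype.ext (by simp [s, hr, hσ0])
    have e3 := hk (σ (p x)) (s x) r
    rw [hr, h0] at e3
    simp only [cobound, ← hs] at e3
    have e4 := hl₀ (s x) r
    simp only [k₁, l, e1, e2, map_add, hr, add_zero, hσ0, hk_zero']
    rw [AddSubgroup.coe_add]
    linear_combination (norm := module) e3 + e4
  have hR' (x : P) (r : p.ker) : k₁ r x = 0 := by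
    have := hck₁ r x
    rw [show p r = 0 from r.2, c0, hR] at this
    simpa using this.symm
  have inv₂ (x y : P) : k₁ x (σ (p y)) = k₁ x y := by
    have e := hk₁ x (σ (p y)) (s y)
    rw [show p (s y) = 0 from (s y).2, h0] at e
    simp only [cobound, hR, ← hs] at e
    linear_combination (norm := module) e
  have inv₁ (x y : P) : k₁ (σ (p x)) y = k₁ x y := by
    have e1 := hck₁ (σ (p x)) y
    have e2 := hck₁ x y
    rw [hσ, e2, inv₂] at e1
    linear_combination (norm := module) -e1
  have inv (x y : P) : k₁ (σ (p x)) (σ (p y)) = k₁ x y := by rw [inv₁, inv₂]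
  refine ⟨fun a b => k₁ (σ a) (σ b), ⟨?_, ?_⟩, fun x hx y hy => ?_⟩
  · rintro _ ⟨x, rfl⟩ _ ⟨y, rfl⟩ _ ⟨z, rfl⟩
    simp only [cobound, ← map_add, inv, hk₁]
  · rintro _ ⟨x, rfl⟩ _ ⟨y, rfl⟩
    simp only [inv, hck₁]
  · beta_reduce
    rw [inv]
    simp only [k₁, hkS x hx y hy, hlS x hx, hlS y hy, hlS _ (S.add_mem hx hy)]
    simp

namespace IsSymmCocycle

variable {h : A → A → A → M} {c : A → A → M}

theorem exists_normalization (H : IsSymmCocycle h c) :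
    ∃ k : A → A → M, (∀ x, h x 0 0 = cobound k x 0 0) ∧ (∀ x, h 0 0 x = cobound k 0 0 x) ∧
      ∀ x y, h x 0 0 = 0 → h 0 0 y = 0 → k x y = 0 := by
  classical
  have h000 : h 0 0 0 = 0 := by simpa using H.pentagon 0 0 0 0
  refine ⟨fun x y => if y = 0 then - h x 0 0 else if x = 0 then h 0 0 y else 0, fun x => ?_,
    fun x => ?_, fun x y hx hy => ?_⟩
  · simp [cobound, h000]
  · by_cases hx : x = 0 <;> simp [cobound, h000, hx]
  · simp only [hx, neg_zero]
    split_ifs <;> simp [hy]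

theorem normalized (H : IsSymmCocycle h c) (h1 : ∀ x, h x 0 0 = 0) (h2 : ∀ x, h 0 0 x = 0) :
    (∀ x y, h x y 0 = 0) ∧ (∀ x y, h x 0 y = 0) ∧ (∀ x y, h 0 x y = 0) ∧ (∀ x, c x 0 = 0) ∧
      ∀ x, c 0 x = 0 := by
  have h3 (x y) : h x y 0 = 0 := by simpa [h1] using H.pentagon x y 0 0
  have h4 (x y) : h x 0 y = 0 := by simpa [h1, h2] using H.pentagon x 0 0 y
  have h5 (x y) : h 0 x y = 0 := by simpa [h2] using H.pentagon 0 0 x y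
  have h6 (x) : c x 0 = 0 := by simpa [h1, h2, h4, h5] using (H.hexagon x 0 0).symm
  exact ⟨h3, h4, h5, h6, fun x => by simpa [h6] using H.symm x 0⟩

theorem exists_trivialization_sup_of_normalized (H : IsSymmCocycle h c) (hself : ∀ x, c x x = 0)
    (h1 : ∀ x, h x 0 0 = 0) (h2 : ∀ x, h 0 0 x = 0) (B : AddSubgroup A)
    (hB : Trivializes 0 h c B) (a : A) :
    ∃ k : A → A → M, Trivializes k h c (B ⊔ AddSubgroup.zmultiples a) ∧
      ∀ x ∈ B, ∀ y ∈ B, k x y = 0 := by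
  obtain ⟨h3, h4, h5, h6, h7⟩ := H.normalized h1 h2
  let p : B × ℤ →+ A := B.subtype.coprod (zmultiplesHom A a)
  have hp (b : B) : p (b, 0) = b := by simp [p]
  obtain ⟨k, hk, hck, hkB⟩ := (H.comap p).exists_trivialization_prod_int (fun x => hself _)
    (fun x y => by simp [h4]) (fun x y => by simp [h5]) (fun x => by simp [h6])
    (fun b b' b'' => by
      simp only [hp]
      rw [hB.assoc b b.2 b' b'.2 b'' b''.2]
      simp [cobound])
    (fun b b' => by
      simp only [hp]
      rw [hB.comm b b.2 b' b'.2]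
      simp)
  obtain ⟨k', hk', hk'B⟩ := exists_descent p h3 h7 hk hck (hkB 0 0) (AddMonoidHom.snd B ℤ)
    (by
      rintro ⟨b, n⟩ hx hn
      obtain rfl : n = 0 := hn
      rw [hp] at hx
      simpa using hx)
    (AddMonoidHom.inl B ℤ).range
    (by
      rintro _ ⟨b, rfl⟩ _ ⟨b', rfl⟩ e
      simp only [AddMonoidHom.inl_apply, hp] at e ⊢
      rw [Subtype.ext e])
    (by
      rintro _ ⟨b, rfl⟩ _ ⟨b', rfl⟩
      exact hkB b b')
  have hr : p.range = B ⊔ AddSubgroup.zmultiples a := by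
    refine le_antisymm ?_ (sup_le (fun x hx => ⟨(⟨x, hx⟩, 0), hp _⟩) ?_)
    · rintro _ ⟨⟨b, n⟩, rfl⟩
      simpa [p] using add_mem (AddSubgroup.mem_sup_left b.2)
        (AddSubgroup.mem_sup_right (zsmul_mem (AddSubgroup.mem_zmultiples a) n))
    · rw [AddSubgroup.zmultiples_le]
      exact ⟨(0, 1), by simp [p]⟩
  refine ⟨k', hr ▸ hk', fun x hx y hy => ?_⟩
  simpa [hp] using hk'B _ ⟨⟨x, hx⟩, rfl⟩ _ ⟨⟨y, hy⟩, rfl⟩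

theorem trivializes_sub_cobound_iff {k k' : A → A → M} {B : AddSubgroup A} :
    Trivializes k' (fun x y z => h x y z - cobound k x y z)
      (fun x y => c x y - (k x y - k y x)) B ↔ Trivializes (k + k') h c B := by
  constructor
  · refine fun ⟨h1, h2⟩ => ⟨fun x hx y hy z hz => ?_, fun x hx y hy => ?_⟩
    · have := h1 x hx y hy z hz
      simp only [cobound, Pi.add_apply] at this ⊢
      linear_combination (norm := module) this
    · have := h2 x hx y hy
      simp only [Pi.add_apply]
      linear_combination (norm := module) this
  · refine fun ⟨h1, h2⟩ => ⟨fun x hx y hy z hz => ?_, fun x hx y hy => ?_⟩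
    · have := h1 x hx y hy z hz
      simp only [cobound, Pi.add_apply] at this ⊢
      linear_combination (norm := module) this
    · have := h2 x hx y hy
      simp only [Pi.add_apply] at this
      linear_combination (norm := module) this

theorem exists_trivialization_sup_of_zero (H : IsSymmCocycle h c) (hself : ∀ x, c x x = 0)
    (B : AddSubgroup A) (hB : Trivializes 0 h c B) (a : A) :
    ∃ k : A → A → M, Trivializes k h c (B ⊔ AddSubgroup.zmultiples a) ∧
      ∀ x ∈ B, ∀ y ∈ B, k x y = 0 := by
  obtain ⟨n, hn1, hn2, hnB⟩ := H.exists_normalization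
  have hhB (x y z : A) (hx : x ∈ B) (hy : y ∈ B) (hz : z ∈ B) : h x y z = 0 := by
    rw [hB.assoc x hx y hy z hz]
    simp [cobound]
  have hnB' (x y : A) (hx : x ∈ B) (hy : y ∈ B) : n x y = 0 :=
    hnB x y (hhB _ _ _ hx B.zero_mem B.zero_mem) (hhB _ _ _ B.zero_mem B.zero_mem hy)
  obtain ⟨k, hk, hkB⟩ := (H.sub_cobound n).exists_trivialization_sup_of_normalized
    (fun x => by simp [hself]) (fun x => sub_eq_zero.2 (hn1 x)) (fun x => sub_eq_zero.2 (hn2 x)) B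
    ⟨fun x hx y hy z hz => by
      simp [cobound, hhB x y z hx hy hz, hnB' y z hy hz, hnB' x y hx hy,
        hnB' _ z (B.add_mem hx hy) hz, hnB' x _ hx (B.add_mem hy hz)],
    fun x hx y hy => by
      simp [hB.comm x hx y hy, hnB' x y hx hy, hnB' y x hy hx]⟩ a
  refine ⟨n + k, trivializes_sub_cobound_iff.1 hk, fun x hx y hy => ?_⟩
  simp [hnB' x y hx hy, hkB x hx y hy]

theorem exists_trivialization_sup (H : IsSymmCocycle h c) (hself : ∀ x, c x x = 0)
    (B : AddSubgroup A) (k : A → A → M) (hB : Trivializes k h c B) (a : A) :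
    ∃ k' : A → A → M, Trivializes k' h c (B ⊔ AddSubgroup.zmultiples a) ∧
      ∀ x ∈ B, ∀ y ∈ B, k' x y = k x y := by
  obtain ⟨k', hk, hkB⟩ := (H.sub_cobound k).exists_trivialization_sup_of_zero
    (fun x => by simp [hself]) B (trivializes_sub_cobound_iff.2 (by simpa using hB)) a
  exact ⟨k + k', trivializes_sub_cobound_iff.1 hk, fun x hx y hy => by simp [hkB x hx y hy]⟩

theorem exists_trivialization_top (H : IsSymmCocycle h c) (hself : ∀ x, c x x = 0) :
    ∃ k : A → A → M, Trivializes k h c ⊤ := by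
  classical
  let T := {Bk : AddSubgroup A × (A → A → M) // Trivializes Bk.2 h c Bk.1}
  let r : T → T → Prop := fun s t =>
    s.1.1 ≤ t.1.1 ∧ ∀ x ∈ s.1.1, ∀ y ∈ s.1.1, t.1.2 x y = s.1.2 x y
  have hrefl (s : T) : r s s := ⟨le_rfl, fun _ _ _ _ => rfl⟩
  have htrans {s t w : T} (h1 : r s t) (h2 : r t w) : r s w :=
    ⟨h1.1.trans h2.1, fun x hx y hy => (h2.2 x (h1.1 hx) y (h1.1 hy)).trans (h1.2 x hx y hy)⟩
  have hbot : Trivializes (fun _ _ => h 0 0 0) h c ⊥ := by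
    refine ⟨?_, ?_⟩
    · rintro x rfl y rfl z rfl
      simpa [cobound] using H.pentagon 0 0 0 0
    · rintro x rfl y rfl
      simp [hself]
  obtain ⟨m, hm⟩ := exists_maximal_of_chains_bounded (r := r) (fun S hS => by
    rcases S.eq_empty_or_nonempty with rfl | hne
    · exact ⟨⟨(⊥, _), hbot⟩, by simp⟩
    have tot : ∀ s ∈ S, ∀ t ∈ S, r s t ∨ r t s := fun s hs t ht => by
      by_cases e : s = t
      · exact .inl (e ▸ hrefl s)
      · exact hS hs ht e
    have mem_sup (x : A) : x ∈ sSup ((fun s : T => s.1.1) '' S) ↔ ∃ s ∈ S, x ∈ s.1.1 := by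
      rw [AddSubgroup.mem_sSup_of_directedOn (hne.image _)]
      · simp
      · rintro _ ⟨s, hs, rfl⟩ _ ⟨t, ht, rfl⟩
        rcases tot s hs t ht with hst | hst
        · exact ⟨_, ⟨t, ht, rfl⟩, hst.1, le_rfl⟩
        · exact ⟨_, ⟨s, hs, rfl⟩, le_rfl, hst.1⟩
    let k : A → A → M := fun x y =>
      if e : ∃ s ∈ S, x ∈ s.1.1 ∧ y ∈ s.1.1 then e.choose.1.2 x y else 0
    have hk (s) (hs : s ∈ S) (x) (hx : x ∈ s.1.1) (y) (hy : y ∈ s.1.1) : k x y = s.1.2 x y := by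
      have e : ∃ s ∈ S, x ∈ s.1.1 ∧ y ∈ s.1.1 := ⟨s, hs, hx, hy⟩
      simp only [k, dif_pos e]
      obtain ⟨h1, h2, h3⟩ := e.choose_spec
      rcases tot s hs _ h1 with hst | hst
      · exact hst.2 x hx y hy
      · exact (hst.2 x h2 y h3).symm
    have hpair (s) (hs : s ∈ S) (t) (ht : t ∈ S) : ∃ w ∈ S, s.1.1 ≤ w.1.1 ∧ t.1.1 ≤ w.1.1 := by
      rcases tot s hs t ht with hst | hst
      · exact ⟨t, ht, hst.1, le_rfl⟩
      · exact ⟨s, hs, le_rfl, hst.1⟩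
    refine ⟨⟨(sSup ((fun s : T => s.1.1) '' S), k), ⟨fun x hx y hy z hz => ?_,
      fun x hx y hy => ?_⟩⟩, fun s hs => ⟨fun x hx => (mem_sup x).2 ⟨s, hs, hx⟩, hk s hs⟩⟩
    · obtain ⟨s, hs, hx⟩ := (mem_sup x).1 hx
      obtain ⟨t, ht, hy⟩ := (mem_sup y).1 hy
      obtain ⟨u, hu, hz⟩ := (mem_sup z).1 hz
      obtain ⟨v, hv, hsv, htv⟩ := hpair s hs t ht
      obtain ⟨w, hw, hvw, huw⟩ := hpair v hv u hu
      replace hx := hvw (hsv hx)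
      replace hy := hvw (htv hy)
      replace hz := huw hz
      rw [w.2.assoc x hx y hy z hz]
      simp only [cobound]
      rw [hk w hw y hy z hz, hk w hw x hx y hy, hk w hw _ (add_mem hx hy) z hz,
        hk w hw x hx _ (add_mem hy hz)]
    · obtain ⟨s, hs, hx⟩ := (mem_sup x).1 hx
      obtain ⟨t, ht, hy⟩ := (mem_sup y).1 hy
      obtain ⟨w, hw, hsw, htw⟩ := hpair s hs t ht
      replace hx := hsw hx
      replace hy := htw hy
      rw [w.2.comm x hx y hy]
      dsimp only
      rw [hk w hw x hx y hy, hk w hw y hy x hx]) htrans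
  obtain ⟨⟨B, k⟩, hBk⟩ := m
  suffices B = ⊤ by
    subst this
    exact ⟨k, hBk⟩
  rw [eq_top_iff]
  intro a _
  obtain ⟨k', hk', hkB⟩ := H.exists_trivialization_sup hself B k hBk a
  have := hm ⟨(_, k'), hk'⟩ ⟨le_sup_left, hkB⟩
  exact this.1 (AddSubgroup.mem_sup_right (AddSubgroup.mem_zmultiples a))

/-- A two-torsion-valued additive map is the diagonal of a symmetric biadditive map. -/
theorem exists_biadditive_diagonal (q : A →+ M) (hq : ∀ x, q x + q x = 0) :
    ∃ b : A → A → M, (∀ x y z, b x (y + z) = b x y + b x z) ∧ (∀ x y, b x y = b y x) ∧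
      (∀ x y, b x y + b x y = 0) ∧ ∀ x, b x x = q x := by
  let V := q.range
  have hV (v : V) : v + v = 0 := by
    obtain ⟨_, x, rfl⟩ := v
    exact Subtype.ext (hq x)
  let : Module (ZMod 2) V := AddCommGroup.zmodModule (n := 2) fun v => by rw [two_nsmul, hV]
  obtain ⟨ι, e⟩ := Module.Free.exists_basis (R := ZMod 2) (M := V)
  let r := e.repr
  let Q : A →+ V := q.rangeRestrict
  refine ⟨fun x y => (r.symm (r (Q x) * r (Q y)) : V), fun x y z => ?_, fun x y => ?_,
    fun x y => ?_, fun x => ?_⟩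
  · simp [mul_add]
  · beta_reduce
    rw [mul_comm]
  · exact congrArg Subtype.val (hV _)
  · have : r (Q x) * r (Q x) = r (Q x) := by
      ext i
      rw [Finsupp.mul_apply]
      generalize r (Q x) i = t
      revert t
      decide
    beta_reduce
    rw [this, LinearEquiv.symm_apply_apply]
    rfl

theorem exists_cobound_eq (H : IsSymmCocycle h c) :
    ∃ k : A → A → M, ∀ x y z, h x y z = cobound k x y z := by
  obtain ⟨b, hb1, hb2, hb3, hb4⟩ := exists_biadditive_diagonal
    (AddMonoidHom.mk' (fun x => c x x) fun x y => H.self_add x y) fun x => H.symm x x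
  have H' : IsSymmCocycle h fun x y => c x y - b x y :=
    { pentagon := H.pentagon
      hexagon := fun x y z => by
        rw [H.hexagon, hb1]
        abel
      symm := fun x y => by
        have e1 := H.symm x y
        have e2 := hb3 x y
        rw [hb2 y x]
        linear_combination (norm := module) e1 - e2 }
  obtain ⟨k, hk⟩ := H'.exists_trivialization_top fun x => by simp [hb4]
  exact ⟨k, fun x y z => hk.assoc x trivial y trivial z trivial⟩

end IsSymmCocycle

end SymmetricCocycles

section Scalars

variable {C : Type u} [Groupoid.{v} C] [MonoidalCategory C]

variable (C) in
/-- The automorphisms of the unit of a monoidal groupoid, written additively. -/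
def Scalar : Type v := Additive (End (𝟙_ C))

instance : AddGroup (Scalar C) := inferInstanceAs (AddGroup (Additive (End (𝟙_ C))))

/-- The endomorphism of `𝟙_ C` underlying a scalar. -/
def Scalar.hom (m : Scalar C) : 𝟙_ C ⟶ 𝟙_ C := Additive.toMul (α := End (𝟙_ C)) m

/-- The scalar given by an endomorphism of `𝟙_ C`. -/
def Scalar.of (f : 𝟙_ C ⟶ 𝟙_ C) : Scalar C := Additive.ofMul (α := End (𝟙_ C)) f

theorem Scalar.hom_of (f : 𝟙_ C ⟶ 𝟙_ C) : (Scalar.of f).hom = f := rfl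

theorem Scalar.hom_zero : (0 : Scalar C).hom = 𝟙 (𝟙_ C) := rfl

theorem Scalar.hom_add (m n : Scalar C) : (m + n).hom = n.hom ≫ m.hom := rfl

theorem Scalar.hom_injective : Function.Injective (Scalar.hom (C := C)) := fun _ _ h => h

/-- The endomorphism of `X` given by the action of a scalar on the left. -/
def scalarEnd (m : Scalar C) (X : C) : X ⟶ X := (λ_ X).inv ≫ m.hom ▷ X ≫ (λ_ X).hom

theorem scalarEnd_unit (m : Scalar C) : scalarEnd m (𝟙_ C) = m.hom := by
  simp [scalarEnd, unitors_equal, unitors_inv_equal]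

theorem scalarEnd_zero (X : C) : scalarEnd 0 X = 𝟙 X := by
  simp [scalarEnd, Scalar.hom_zero]

theorem scalarEnd_naturality (m : Scalar C) {X Y : C} (f : X ⟶ Y) :
    f ≫ scalarEnd m Y = scalarEnd m X ≫ f := by
  simp only [scalarEnd, Category.assoc]
  rw [leftUnitor_inv_naturality_assoc, whisker_exchange_assoc, leftUnitor_naturality]

instance : AddCommGroup (Scalar C) where
  add_comm m n := Scalar.hom_injective <| by
    simpa only [scalarEnd_unit, Scalar.hom_add] using scalarEnd_naturality m n.hom

theorem scalarEnd_add (m n : Scalar C) (X : C) :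
    scalarEnd (m + n) X = scalarEnd m X ≫ scalarEnd n X := by
  rw [add_comm]
  simp [scalarEnd, Scalar.hom_add]

instance (X Y : C) : AddAction (Scalar C) (X ⟶ Y) where
  vadd m f := scalarEnd m X ≫ f
  zero_vadd f := by
    change scalarEnd 0 X ≫ f = f
    rw [scalarEnd_zero, Category.id_comp]
  add_vadd m n f := by
    change scalarEnd (m + n) X ≫ f = scalarEnd m X ≫ scalarEnd n X ≫ f
    rw [scalarEnd_add, Category.assoc]

theorem scalar_vadd_def (m : Scalar C) {X Y : C} (f : X ⟶ Y) : m +ᵥ f = scalarEnd m X ≫ f := rfl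

theorem scalar_vadd_comp (m : Scalar C) {X Y Z : C} (f : X ⟶ Y) (g : Y ⟶ Z) :
    (m +ᵥ f) ≫ g = m +ᵥ (f ≫ g) := by
  simp only [scalar_vadd_def, Category.assoc]

theorem comp_scalar_vadd (m : Scalar C) {X Y Z : C} (f : X ⟶ Y) (g : Y ⟶ Z) :
    f ≫ (m +ᵥ g) = m +ᵥ (f ≫ g) := by
  simp only [scalar_vadd_def, ← Category.assoc, scalarEnd_naturality]

theorem scalar_vadd_whiskerRight (m : Scalar C) {X Y : C} (f : X ⟶ Y) (Z : C) :
    (m +ᵥ f) ▷ Z = m +ᵥ (f ▷ Z) := by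
  simp [scalar_vadd_def, scalarEnd]

theorem whiskerLeft_scalar_vadd [BraidedCategory C] (m : Scalar C) {X Y : C} (f : X ⟶ Y) (Z : C) :
    Z ◁ (m +ᵥ f) = m +ᵥ (Z ◁ f) := by
  rw [← cancel_mono (β_ Z Y).hom, scalar_vadd_comp, BraidedCategory.braiding_naturality_right,
    BraidedCategory.braiding_naturality_right, scalar_vadd_whiskerRight, comp_scalar_vadd]

theorem scalar_vadd_unit (m : Scalar C) : m +ᵥ 𝟙 (𝟙_ C) = m.hom := by
  rw [scalar_vadd_def, scalarEnd_unit, Category.comp_id]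

variable [BraidedCategory C] {X Y : C}

theorem scalar_vadd_injective (hX : ∃ Z : C, Nonempty (Z ⊗ X ≅ 𝟙_ C)) (f : X ⟶ Y)
    {m n : Scalar C} (h : m +ᵥ f = n +ᵥ f) : m = n := by
  obtain ⟨Z, ⟨e⟩⟩ := hX
  have h₁ : e.inv ≫ Z ◁ ((m +ᵥ f) ≫ inv f) ≫ e.hom = e.inv ≫ Z ◁ ((n +ᵥ f) ≫ inv f) ≫ e.hom := by
    rw [h]
  simp only [scalar_vadd_comp, IsIso.hom_inv_id, whiskerLeft_scalar_vadd, whiskerLeft_id,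
    comp_scalar_vadd, Category.id_comp, Iso.inv_hom_id, scalar_vadd_unit] at h₁
  exact Scalar.hom_injective h₁

theorem exists_scalar_vadd_eq (hX : ∃ Z : C, Nonempty (Z ⊗ X ≅ 𝟙_ C)) (f g : X ⟶ Y) :
    ∃ m : Scalar C, g = m +ᵥ f := by
  obtain ⟨Z, ⟨e⟩⟩ := hX
  have faithful {a b : X ⟶ X} (h : Z ◁ a = Z ◁ b) : a = b := by
    let d : X ⊗ Z ≅ 𝟙_ C := β_ X Z ≪≫ e
    have h₁ : d.inv ▷ X ≫ (X ⊗ Z) ◁ a ≫ d.hom ▷ X = d.inv ▷ X ≫ (X ⊗ Z) ◁ b ≫ d.hom ▷ X := by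
      simp only [tensor_whiskerLeft, h]
    simpa only [whisker_exchange, inv_hom_whiskerRight_assoc, id_whiskerLeft, cancel_epi,
      cancel_mono] using h₁
  refine ⟨Scalar.of (e.inv ≫ Z ◁ (g ≫ inv f) ≫ e.hom), ?_⟩
  rw [← cancel_mono (inv f), scalar_vadd_comp, IsIso.hom_inv_id]
  apply faithful
  rw [whiskerLeft_scalar_vadd, whiskerLeft_id, ← cancel_epi e.inv, ← cancel_mono e.hom,
    comp_scalar_vadd, scalar_vadd_comp, Category.comp_id, e.inv_hom_id, scalar_vadd_unit,
    Scalar.hom_of, Category.assoc]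

end Scalars

section Multiplier

variable {C : Type u} [Groupoid.{v} C] [MonoidalCategory C] {G : Type u}

/-- A system of comparison isomorphisms making `X : G → C` multiplicative. The target is indexed by
any `c` equal to `a * b`, which avoids transport along equalities of objects. -/
abbrev Multiplier [Mul G] (X : G → C) : Type (max u v) :=
  ∀ ⦃a b c : G⦄, a * b = c → (X a ⊗ X b ⟶ X c)

namespace Multiplier

theorem comp_eqToHom [Mul G] {X : G → C} (t : Multiplier X) {a b c d : G} (h : a * b = c)
    (e : c = d) : t h ≫ eqToHom (congrArg X e) = t (h.trans e) := by
  subst e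
  simp

variable [CommGroup G] {X : G → C}

/-- `h` measures the failure of `t` to be associative. -/
def HasAssociator (t : Multiplier X) (h : G → G → G → Scalar C) : Prop :=
  ∀ ⦃a b c ab bc abc : G⦄ (h₁ : a * b = ab) (h₂ : b * c = bc) (h₃ : ab * c = abc)
    (h₄ : a * bc = abc),
    t h₁ ▷ X c ≫ t h₃ = h a b c +ᵥ ((α_ (X a) (X b) (X c)).hom ≫ X a ◁ t h₂ ≫ t h₄)

/-- `c` measures the failure of `t` to be commutative. -/
def HasBraiding [BraidedCategory C] (t : Multiplier X) (c : G → G → Scalar C) : Prop :=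
  ∀ ⦃a b ab : G⦄ (h₁ : a * b = ab) (h₂ : b * a = ab),
    (β_ (X a) (X b)).hom ≫ t h₂ = c a b +ᵥ t h₁

variable {t : Multiplier X} {h : G → G → G → Scalar C} {s : G → G → Scalar C}

section

variable [BraidedCategory C] (hinv : ∀ x : C, ∃ y : C, Nonempty (y ⊗ x ≅ 𝟙_ C))

include hinv

theorem exists_hasAssociator (t : Multiplier X) : ∃ h, t.HasAssociator h := by
  choose h hh using fun a b c : G => exists_scalar_vadd_eq (hinv _)
    ((α_ (X a) (X b) (X c)).hom ≫ X a ◁ t (rfl : b * c = b * c) ≫ t (mul_assoc a b c).symm)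
    (t (rfl : a * b = a * b) ▷ X c ≫ t rfl)
  refine ⟨h, fun a b c ab bc abc h₁ h₂ h₃ h₄ => ?_⟩
  subst h₁ h₂ h₃
  exact hh a b c

theorem exists_hasBraiding (t : Multiplier X) : ∃ s, t.HasBraiding s := by
  choose s hs using fun a b : G => exists_scalar_vadd_eq (hinv _)
    (t (rfl : a * b = a * b)) ((β_ (X a) (X b)).hom ≫ t (mul_comm b a))
  refine ⟨s, fun a b ab h₁ h₂ => ?_⟩
  subst h₁
  exact hs a b

theorem HasAssociator.pentagon (H : t.HasAssociator h) (a b c d : G) :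
    h a b c + h a (b * c) d + h b c d = h (a * b) c d + h a b (c * d) := by
  have e₁ := H (rfl : a * b = a * b) (rfl : b * c = b * c) rfl (mul_assoc a b c).symm
  have e₂ := H (mul_assoc a b c).symm (rfl : b * c * d = b * c * d) (rfl : a * b * c * d = _)
    (by simp only [mul_assoc])
  have e₃ := H (rfl : b * c = b * c) (rfl : c * d = c * d) rfl (mul_assoc b c d).symm
  have e₄ := H (rfl : a * b * c = _) (rfl : c * d = c * d) (rfl : a * b * c * d = _)
    (by simp only [mul_assoc])
  have e₅ := H (rfl : a * b = _) (mul_assoc b c d).symm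
    (by simp only [mul_assoc] : a * b * (c * d) = a * b * c * d) (by simp only [mul_assoc])
  have f₁ : t (rfl : a * b = _) ▷ X c ▷ X d ≫ t (rfl : a * b * c = _) ▷ X d ≫ t rfl =
      (h a b c + h a (b * c) d + h b c d) +ᵥ ((α_ (X a) (X b) (X c)).hom ▷ X d ≫
        (α_ (X a) (X b ⊗ X c) (X d)).hom ≫ X a ◁ (α_ (X b) (X c) (X d)).hom ≫
        X a ◁ X b ◁ t (rfl : c * d = _) ≫ X a ◁ t (mul_assoc b c d).symm ≫
        t (by simp only [mul_assoc])) := by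
    rw [← comp_whiskerRight_assoc, e₁, scalar_vadd_whiskerRight, scalar_vadd_comp]
    simp only [comp_whiskerRight, Category.assoc]
    rw [e₂, comp_scalar_vadd, comp_scalar_vadd, associator_naturality_middle_assoc,
      ← whiskerLeft_comp_assoc, e₃, whiskerLeft_scalar_vadd, scalar_vadd_comp]
    simp only [comp_scalar_vadd, whiskerLeft_comp, Category.assoc, ← add_vadd, add_assoc]
  have f₂ : t (rfl : a * b = _) ▷ X c ▷ X d ≫ t (rfl : a * b * c = _) ▷ X d ≫ t rfl =
      (h (a * b) c d + h a b (c * d)) +ᵥ ((α_ (X a ⊗ X b) (X c) (X d)).hom ≫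
        (α_ (X a) (X b) (X c ⊗ X d)).hom ≫
        X a ◁ X b ◁ t (rfl : c * d = _) ≫ X a ◁ t (mul_assoc b c d).symm ≫
        t (by simp only [mul_assoc])) := by
    rw [e₄, comp_scalar_vadd, associator_naturality_left_assoc, ← whisker_exchange_assoc, e₅]
    simp only [comp_scalar_vadd, tensor_whiskerLeft, Category.assoc, Iso.inv_hom_id_assoc,
      ← add_vadd]
  rw [f₁, ← MonoidalCategory.pentagon_assoc] at f₂
  exact scalar_vadd_injective (hinv _) _ f₂

theorem HasAssociator.hexagon (H : t.HasAssociator h) (S : t.HasBraiding s) (a b c : G) :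
    h b a c + s a (b * c) = h a b c + h b c a + s a c + s a b := by
  have f₁ := S (rfl : a * (b * c) = _) (mul_comm (b * c) a)
  have f₂ := H (rfl : b * c = _) (mul_comm c a) (mul_comm (b * c) a) (mul_left_comm b a c)
  have f₃ := S (rfl : a * c = _) (mul_comm c a)
  have f₄ := H (mul_comm b a) (rfl : a * c = _) (mul_assoc a b c) (mul_left_comm b a c)
  have f₅ := S (rfl : a * b = _) (mul_comm b a)
  have f₆ := H (rfl : a * b = _) (rfl : b * c = _) (mul_assoc a b c) rfl
  have e := congrArg (h b a c +ᵥ (α_ (X a) (X b) (X c)).hom ≫ ·)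
    (BraidedCategory.braiding_naturality_right_assoc (X a) (t (rfl : b * c = _))
      (t (mul_comm (b * c) a)))
  beta_reduce at e
  rw [f₁, f₂, comp_scalar_vadd, comp_scalar_vadd, comp_scalar_vadd, comp_scalar_vadd,
    BraidedCategory.hexagon_forward_assoc, ← whiskerLeft_comp_assoc, f₃, whiskerLeft_scalar_vadd,
    scalar_vadd_comp, comp_scalar_vadd, comp_scalar_vadd, vadd_comm (h b a c) (h b c a),
    vadd_comm (h b a c) (s a c), ← comp_scalar_vadd _ ((β_ (X a) (X b)).hom ▷ X c), ← f₄, ← comp_whiskerRight_assoc, f₅,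
    scalar_vadd_whiskerRight, scalar_vadd_comp, f₆] at e
  simp only [← add_vadd] at e
  rw [scalar_vadd_injective (hinv _) _ e]
  abel

end

theorem HasBraiding.symm [SymmetricCategory C]
    (hinv : ∀ x : C, ∃ y : C, Nonempty (y ⊗ x ≅ 𝟙_ C)) (S : t.HasBraiding s) (a b : G) :
    s a b + s b a = 0 := by
  have e := congrArg ((β_ (X a) (X b)).hom ≫ ·) (S (mul_comm b a) (rfl : a * b = _))
  rw [SymmetricCategory.symmetry_assoc, comp_scalar_vadd, S rfl, ← add_vadd, add_comm] at e
  exact (scalar_vadd_injective (hinv _) _ ((zero_vadd _ _).trans e)).symm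

/-- Every multiplier on an invertible family can be corrected to an associative one. -/
theorem exists_associative [SymmetricCategory C]
    (hinv : ∀ x : C, ∃ y : C, Nonempty (y ⊗ x ≅ 𝟙_ C)) (t : Multiplier X) :
    ∃ t' : Multiplier X, t'.HasAssociator 0 := by
  obtain ⟨h, H⟩ := exists_hasAssociator hinv t
  obtain ⟨s, S⟩ := exists_hasBraiding hinv t
  have hs : IsSymmCocycle (A := Additive G) (M := Scalar C) h s :=
    { pentagon := fun (x y z w : G) => by
        have := H.pentagon hinv x y z w
        change h y z w - h (x * y) z w + h x (y * z) w - h x y (z * w) + h x y z = 0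
        linear_combination (norm := module) this
      hexagon := fun (x y z : G) => by
        have := H.hexagon hinv S x y z
        change h x y z + h y z x - h y x z = s x (y * z) - s x y - s x z
        linear_combination (norm := module) -this
      symm := fun x y => S.symm hinv x y }
  obtain ⟨k, hk⟩ := hs.exists_cobound_eq
  replace hk (a b c : G) : h a b c = k b c - k (a * b) c + k a (b * c) - k a b := hk a b c
  refine ⟨fun a b c e => k a b +ᵥ t e, fun a b c ab bc abc h₁ h₂ h₃ h₄ => ?_⟩
  dsimp only
  rw [scalar_vadd_whiskerRight, whiskerLeft_scalar_vadd]
  simp only [scalar_vadd_comp, comp_scalar_vadd]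
  rw [H h₁ h₂ h₃ h₄, hk, h₁, h₂]
  simp only [← add_vadd, Pi.zero_apply, zero_add]
  congr 1
  abel

section Unit

variable (T : t.HasAssociator 0)

include T

theorem HasAssociator.assoc ⦃a b c ab bc abc : G⦄ (h₁ : a * b = ab) (h₂ : b * c = bc)
    (h₃ : ab * c = abc) (h₄ : a * bc = abc) :
    t h₁ ▷ X c ≫ t h₃ = (α_ (X a) (X b) (X c)).hom ≫ X a ◁ t h₂ ≫ t h₄ :=
  (T h₁ h₂ h₃ h₄).trans (zero_vadd _ _)

theorem HasAssociator.exists_unit [BraidedCategory C]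
    (hinv : ∀ x : C, ∃ y : C, Nonempty (y ⊗ x ≅ 𝟙_ C))
    (e₀ : 𝟙_ C ⟶ X 1) :
    ∃ e : 𝟙_ C ⟶ X 1, (∀ a, e ▷ X a ≫ t (one_mul a) = (λ_ (X a)).hom) ∧
      ∀ a, X a ◁ e ≫ t (mul_one a) = (ρ_ (X a)).hom := by
  obtain ⟨m, hm⟩ := exists_scalar_vadd_eq (hinv _) (e₀ ▷ X 1 ≫ t (one_mul 1)) (λ_ (X 1)).hom
  let e : 𝟙_ C ⟶ X 1 := m +ᵥ e₀
  have he : e ▷ X 1 ≫ t (one_mul 1) = (λ_ (X 1)).hom := by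
    rw [hm, scalar_vadd_whiskerRight, scalar_vadd_comp]
  have he' : e ▷ 𝟙_ C ≫ X 1 ◁ e ≫ t (one_mul 1) = (λ_ (𝟙_ C)).hom ≫ e := by
    rw [← whisker_exchange_assoc, he, leftUnitor_naturality]
  refine ⟨e, fun a => ?_, fun a => ?_⟩
  · obtain ⟨r, hr⟩ := exists_scalar_vadd_eq (hinv _) (λ_ (X a)).hom (e ▷ X a ≫ t (one_mul a))
    have f := congrArg ((e ▷ 𝟙_ C ≫ X 1 ◁ e) ▷ X a ≫ ·)
      (T.assoc (one_mul 1) (one_mul a) (one_mul a) (one_mul a))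
    beta_reduce at f
    have f₁ : (e ▷ 𝟙_ C ≫ X 1 ◁ e) ▷ X a ≫ t (one_mul 1) ▷ X a ≫ t (one_mul a) =
        r +ᵥ ((λ_ (𝟙_ C)).hom ▷ X a ≫ (λ_ (X a)).hom) := by
      rw [← comp_whiskerRight_assoc, Category.assoc, he', comp_whiskerRight_assoc, hr,
        comp_scalar_vadd]
    have f₂ : (e ▷ 𝟙_ C ≫ X 1 ◁ e) ▷ X a ≫ (α_ (X 1) (X 1) (X a)).hom ≫ X 1 ◁ t (one_mul a) ≫
        t (one_mul a) = (r + r) +ᵥ ((λ_ (𝟙_ C)).hom ▷ X a ≫ (λ_ (X a)).hom) := by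
      rw [comp_whiskerRight_assoc, associator_naturality_middle_assoc,
        ← whiskerLeft_comp_assoc, hr, associator_naturality_left_assoc,
        ← whisker_exchange_assoc, hr, whiskerLeft_scalar_vadd, scalar_vadd_comp]
      simp only [comp_scalar_vadd, ← add_vadd]
      rw [unitors_equal, ← triangle_assoc]
    rw [f₁, f₂] at f
    have hr₀ : r = 0 := by simpa using scalar_vadd_injective (hinv _) _ f
    rw [hr, hr₀, zero_vadd]
  · obtain ⟨r, hr⟩ := exists_scalar_vadd_eq (hinv _) (ρ_ (X a)).hom (X a ◁ e ≫ t (mul_one a))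
    have f := congrArg ((X a ◁ e) ▷ 𝟙_ C ≫ (X a ⊗ X 1) ◁ e ≫ ·)
      (T.assoc (mul_one a) (mul_one 1) (mul_one a) (mul_one a))
    beta_reduce at f
    have f₁ : (X a ◁ e) ▷ 𝟙_ C ≫ (X a ⊗ X 1) ◁ e ≫ t (mul_one a) ▷ X 1 ≫ t (mul_one a) =
        (r + r) +ᵥ ((ρ_ (X a)).hom ▷ 𝟙_ C ≫ (ρ_ (X a)).hom) := by
      rw [whisker_exchange_assoc, hr, comp_scalar_vadd, comp_scalar_vadd,
        ← comp_whiskerRight_assoc, hr, scalar_vadd_whiskerRight, scalar_vadd_comp, add_vadd]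
    have f₂ : (X a ◁ e) ▷ 𝟙_ C ≫ (X a ⊗ X 1) ◁ e ≫ (α_ (X a) (X 1) (X 1)).hom ≫
        X a ◁ t (mul_one 1) ≫ t (mul_one a) =
        r +ᵥ ((ρ_ (X a)).hom ▷ 𝟙_ C ≫ (ρ_ (X a)).hom) := by
      rw [associator_naturality_right_assoc, associator_naturality_middle_assoc,
        ← whiskerLeft_comp_assoc, ← whiskerLeft_comp_assoc, Category.assoc, he',
        whiskerLeft_comp_assoc, hr]
      simp only [comp_scalar_vadd]
      simp [unitors_equal]
    rw [f₁, f₂] at f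
    have hr₀ : r = 0 := by simpa using scalar_vadd_injective (hinv _) _ f
    rw [hr, hr₀, zero_vadd]

end Unit

end Multiplier

end Multiplier

theorem inducedFunctor_map_eqToHom {C G : Type*} [Category* C] {X : G → C}
    {a b : InducedCategory C X} (h : a = b) :
    (inducedFunctor X).map (eqToHom h) = eqToHom (congrArg X h) := by
  subst h
  rfl

section Model

variable {C : Type u} [Groupoid.{v} C] [MonoidalCategory C] {G : Type u} [CommGroup G] {X : G → C}

/-- The tensor product on the full subcategory of a family of objects given by a multiplier. -/
noncomputable abbrev Multiplier.monoidalStruct (t : Multiplier X) :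
    MonoidalCategoryStruct (InducedCategory C X) where
  tensorObj (a b : G) := (a * b : G)
  tensorUnit := (1 : G)
  whiskerLeft (a : G) (b₁ b₂ : G) f :=
    ⟨inv (t (rfl : a * b₁ = _)) ≫ X a ◁ f.hom ≫ t (rfl : a * b₂ = _)⟩
  whiskerRight {a₁ a₂ : G} f (b : G) :=
    ⟨inv (t (rfl : a₁ * b = _)) ≫ f.hom ▷ X b ≫ t (rfl : a₂ * b = _)⟩
  tensorHom {a₁ b₁ a₂ b₂ : G} f g :=
    ⟨inv (t (rfl : a₁ * a₂ = _)) ≫ (f.hom ⊗ₘ g.hom) ≫ t (rfl : b₁ * b₂ = _)⟩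
  associator (a b c : G) := eqToIso (mul_assoc a b c)
  leftUnitor (a : G) := eqToIso (one_mul a)
  rightUnitor (a : G) := eqToIso (mul_one a)

/-- An associative and unital multiplier is a monoidal structure on the inclusion functor. -/
noncomputable def Multiplier.inducingFunctorData (t : Multiplier X) (T : t.HasAssociator 0)
    (e : 𝟙_ C ⟶ X 1) (hl : ∀ a, e ▷ X a ≫ t (one_mul a) = (λ_ (X a)).hom)
    (hr : ∀ a, X a ◁ e ≫ t (mul_one a) = (ρ_ (X a)).hom) :
    letI := t.monoidalStruct
    Monoidal.InducingFunctorData (inducedFunctor X) :=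
  letI := t.monoidalStruct
  { μIso := fun (a b : G) => asIso (t (rfl : a * b = a * b))
    εIso := asIso e
    whiskerLeft_eq := fun _ _ _ _ => by rfl
    whiskerRight_eq := fun _ _ => by rfl
    tensorHom_eq := fun _ _ => by rfl
    associator_eq := fun (a b c : G) => by
      refine (inducedFunctor_map_eqToHom (X := X) (mul_assoc a b c)).trans ?_
      have := T.assoc (rfl : a * b = _) (rfl : b * c = _) (mul_assoc a b c) rfl
      rw [← t.comp_eqToHom rfl (mul_assoc a b c)] at this
      simp only [Iso.trans_hom, Iso.symm_hom, asIso_inv, tensorIso_hom, Iso.refl_hom, tensorHom_id,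
        id_tensorHom, asIso_hom, Category.assoc]
      erw [← this]
      simp
    leftUnitor_eq := fun (a : G) => by
      refine (inducedFunctor_map_eqToHom (X := X) (one_mul a)).trans ?_
      have := hl a
      rw [← t.comp_eqToHom rfl (one_mul a)] at this
      simp only [Iso.trans_hom, Iso.symm_hom, asIso_inv, tensorIso_hom, Iso.refl_hom, tensorHom_id,
        Category.assoc]
      erw [← this]
      simp
    rightUnitor_eq := fun (a : G) => by
      refine (inducedFunctor_map_eqToHom (X := X) (mul_one a)).trans ?_
      have := hr a
      rw [← t.comp_eqToHom rfl (mul_one a)] at this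
      simp only [Iso.trans_hom, Iso.symm_hom, asIso_inv, tensorIso_hom, Iso.refl_hom, id_tensorHom,
        Category.assoc]
      erw [← this]
      simp }

end Model

/-- The inverse of a braided equivalence is braided. -/
theorem CategoryTheory.Equivalence.nonempty_inverse_braided {C D : Type*} [Category* C]
    [Category* D] [MonoidalCategory C] [MonoidalCategory D] [BraidedCategory C] [BraidedCategory D]
    (e : C ≌ D) [e.functor.Braided] : Nonempty e.inverse.Braided := by
  let _ : e.inverse.Monoidal := e.inverseMonoidal
  have hμ (X Y : D) : Functor.LaxMonoidal.μ e.inverse X Y =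
      e.toAdjunction.homEquiv _ _ (Functor.OplaxMonoidal.δ e.functor _ _ ≫
        (e.toAdjunction.counit.app X ⊗ₘ e.toAdjunction.counit.app Y)) := rfl
  refine ⟨{ braided := fun X Y => ?_ }⟩
  rw [hμ, hμ, ← Adjunction.homEquiv_naturality_right, ← Adjunction.homEquiv_naturality_left,
    Category.assoc]
  congr 1
  simp [Functor.map_braiding, BraidedCategory.braiding_naturality]

theorem SkeletalPermutativeModel.of_unital_multiplier {C : Type u} [Groupoid.{v} C]
    [MonoidalCategory C] [SymmetricCategory C] {G : Type u} [CommGroup G] {X : G → C}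
    (hX : ∀ a b, Nonempty (X a ≅ X b) → a = b) (hX' : ∀ x, ∃ a, Nonempty (X a ≅ x))
    (t : Multiplier X) (T : t.HasAssociator 0)
    (e : 𝟙_ C ⟶ X 1) (hl : ∀ a, e ▷ X a ≫ t (one_mul a) = (λ_ (X a)).hom)
    (hr : ∀ a, X a ◁ e ≫ t (mul_one a) = (ρ_ (X a)).hom) :
    Nonempty (SkeletalPermutativeModel C) := by
  let F := inducedFunctor X
  let _ := t.monoidalStruct
  let data := t.inducingFunctorData T e hl hr
  let _ : MonoidalCategory (InducedCategory C X) := Monoidal.induced F data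
  let _ : F.Monoidal := Monoidal.fromInducedMonoidal F data
  let _ : SymmetricCategory (InducedCategory C X) := SymmetricCategory.ofFullyFaithful F
  have hβ (a b : InducedCategory C X) : F.map (β_ a b).hom =
      (Functor.Monoidal.μIso F a b).inv ≫ (β_ (F.obj a) (F.obj b)).hom ≫
        (Functor.Monoidal.μIso F b a).hom := F.map_preimage _
  let hF : F.Braided := { braided := fun a b => by rw [hβ]; simp }
  have : F.EssSurj := ⟨fun x => hX' x⟩
  have : F.IsEquivalence := { }
  let _ : F.asEquivalence.functor.Braided := hF
  obtain ⟨hB⟩ := F.asEquivalence.nonempty_inverse_braided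
  exact ⟨{
    D := InducedCategory C X
    skeletal := fun a b ⟨i⟩ => hX a b ⟨F.mapIso i⟩
    tensor_assoc := fun a b c => mul_assoc (G := G) a b c
    unit_tensor := fun a => one_mul (M := G) a
    tensor_unit := fun a => mul_one (M := G) a
    associator_eq := fun _ _ _ => rfl
    leftUnitor_eq := fun _ => rfl
    rightUnitor_eq := fun _ => rfl
    equiv := F.asEquivalence.symm
    braided := hB }⟩

/-- Every Picard groupoid is equivalent, as a symmetric monoidal category, to
one which is both skeletal and permutative. -/
theorem stmt_0 (C : Type u) [Groupoid.{v} C] [MonoidalCategory C] [SymmetricCategory C]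
    (hinv : ∀ x : C, ∃ y : C, Nonempty (y ⊗ x ≅ 𝟙_ C)) :
    Nonempty (SkeletalPermutativeModel C) := by
  have out_iso (x : C) : Nonempty ((toSkeleton x).out ≅ x) := ⟨fromSkeletonToSkeletonIso x⟩
  let _ : CommGroup (Skeleton C) := commGroupOfIsUnit fun a => by
    obtain ⟨y, ⟨e⟩⟩ := hinv a.out
    refine IsUnit.of_mul_eq_one_right (toSkeleton y) ?_
    rw [Skeleton.one_eq, ← toSkeleton_eq_toSkeleton_iff.2 ⟨e⟩, Skeleton.toSkeleton_tensorObj]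
    congr 1
    exact (Quotient.out_eq a).symm
  let X : Skeleton C → C := Quotient.out
  have ht ⦃a b c : Skeleton C⦄ (h : a * b = c) : Nonempty (X a ⊗ X b ⟶ X c) :=
    (out_iso (X a ⊗ X b)).map fun i => i.inv ≫ eqToHom (congrArg X h)
  obtain ⟨t, T⟩ := Multiplier.exists_associative hinv fun a b c h => (ht (a := a) (b := b) h).some
  obtain ⟨i⟩ := out_iso (𝟙_ C)
  obtain ⟨e, hl, hr⟩ := T.exists_unit hinv i.inv
  refine SkeletalPermutativeModel.of_unital_multiplier (X := X) (fun a b h => ?_) (fun x => ⟨_, out_iso x⟩) t T e hl hr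
  rw [← Quotient.out_eq a, ← Quotient.out_eq b]
  exact toSkeleton_eq_toSkeleton_iff.2 h
end

section
/- Let n be a positive natural number, let M be an additive abelian group, and let (h, c) be a symmetric 3-cocycle for ℤ/n with coefficients in M. Then n • c(1,1) = 0 in M. -/
/-- A symmetric 3-cocycle for `G` with coefficients in `M`. -/
def IsSymm3Cocycle {G M : Type*} [AddCommGroup G] [AddCommGroup M]
    (h : G → G → G → M) (c : G → G → M) : Prop :=
  (∀ x z, h x 0 z = 0) ∧
  (∀ u x y z, h x y z + h u (x + y) z + h u x y = h u x (y + z) + h (u + x) y z) ∧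
  (∀ x y z, h y z x + c x (y + z) + h x y z = c x z + h y x z + c x y) ∧
  (∀ x y, c x y = - c y x)

/-- Two symmetric 3-cocycles are cohomologous. -/
def Cohomologous {G M : Type*} [AddCommGroup G] [AddCommGroup M]
    (h h' : G → G → G → M) (c c' : G → G → M) : Prop :=
  ∃ k : G → G → M,
    (∀ x, k x 0 = 0) ∧ (∀ y, k 0 y = 0) ∧
    (∀ x y z, h x y z - h' x y z = k y z - k (x + y) z + k x (y + z) - k x y) ∧
    (∀ x y, c x y - c' x y = k x y - k y x)

/-- For a symmetric 3-cocycle, the diagonal `x ↦ c x x` is additive. -/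
theorem IsSymm3Cocycle.diag_add {G M : Type*} [AddCommGroup G] [AddCommGroup M]
    {h : G → G → G → M} {c : G → G → M} (hhc : IsSymm3Cocycle h c) (x y : G) :
    c (x + y) (x + y) = c x x + c y y := by
  obtain ⟨-, hcoc, hhex, hanti⟩ := hhc
  have pentagon := hcoc x y x y
  have hexagon := hhex (x + y) x y
  have hexagon_y := hhex y x y
  have hexagon_x := hhex x x y
  have anti_x := hanti x x
  have anti_y := hanti y y
  have anti_xy := hanti x y
  have anti_sum_x := hanti (x + y) x
  have anti_sum_y := hanti (x + y) y
  rw [add_comm y x] at pentagon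
  linear_combination (norm := abel) hexagon + anti_sum_x + anti_sum_y - hexagon_y - hexagon_x
    + pentagon - anti_xy - anti_x - anti_y

/-- If `(h, c)` is a symmetric 3-cocycle for `ℤ/n` with coefficients in `M`,
then `n • c(1,1) = 0`. -/
theorem stmt_1 (n : ℕ) (hn : 0 < n) (M : Type*) [AddCommGroup M]
    (h : ZMod n → ZMod n → ZMod n → M) (c : ZMod n → ZMod n → M)
    (hhc : IsSymm3Cocycle h c) :
    n • c 1 1 = 0 := by
  let q : ZMod n →+ M := AddMonoidHom.mk' (fun x => c x x) hhc.diag_add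
  calc n • c 1 1 = q (n • 1) := (map_nsmul q n 1).symm
    _ = 0 := by rw [nsmul_one, ZMod.natCast_self, map_zero]
end

section
/- Let G and M be additive abelian groups and let (h, c) be a symmetric 3-cocycle for G with coefficients in M. Then the map q : G → M defined by q(x) = c(x,x) is quadratic: q(x) = q(-x) for all x, and q(x+y+z) + q(x) + q(y) + q(z) = q(y+z) + q(z+x) + q(x+y) for all x, y, z. Moreover 2 • q(x) = 0 for all x. -/
/-- The diagonal of the braiding of a symmetric 3-cocycle is killed by `2`. -/
theorem IsSymm3Cocycle.two_nsmul_diag {G M : Type*} [AddCommGroup G] [AddCommGroup M]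
    {h : G → G → G → M} {c : G → G → M} (hhc : IsSymm3Cocycle h c) (x : G) :
    2 • c x x = 0 := by
  rw [two_nsmul]
  exact eq_neg_iff_add_eq_zero.mp (hhc.2.2.2 x x)

/-- For a symmetric 3-cocycle `(h, c)`, the map `q(x) = c(x,x)` is quadratic,
and `2 • q(x) = 0` for all `x`. -/
theorem stmt_9 (G M : Type*) [AddCommGroup G] [AddCommGroup M]
    (h : G → G → G → M) (c : G → G → M)
    (hhc : IsSymm3Cocycle h c) :
    (∀ x : G, c x x = c (-x) (-x)) ∧
    (∀ x y z : G, c (x + y + z) (x + y + z) + c x x + c y y + c z z =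
      c (y + z) (y + z) + c (z + x) (z + x) + c (x + y) (x + y)) ∧
    (∀ x : G, 2 • c x x = 0) := by
  refine ⟨fun x => ?_, fun x y z => ?_, hhc.two_nsmul_diag⟩
  · have hzero : c 0 0 = 0 := by simpa using hhc.diag_add 0 0
    have hneg := hhc.diag_add x (-x)
    rw [add_neg_cancel, hzero] at hneg
    rw [eq_neg_of_add_eq_zero_left hneg.symm, neg_eq_iff_add_eq_zero, ← two_nsmul]
    exact hhc.two_nsmul_diag (-x)
  · simp only [hhc.diag_add]
    abel
end

section
/- Let n be a positive natural number, let M be an additive abelian group, and let (h, c) be a symmetric 3-cocycle for ℤ/n with coefficients in M. For x ∈ ℤ/n let x̄ ∈ {0, …, n-1} denote its canonical integer representative. Then for every x ∈ ℤ/n one has c(x,x) = (x̄)² • c(1,1). -/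
namespace IsSymm3Cocycle

variable {G M : Type*} [AddCommGroup G] [AddCommGroup M]
  {h : G → G → G → M} {c : G → G → M}

/-- The diagonal of a symmetric 3-cocycle is 2-torsion. -/
theorem diag_add_diag (H : IsSymm3Cocycle h c) (x : G) : c x x + c x x = 0 :=
  eq_neg_iff_add_eq_zero.mp (H.2.2.2 x x)

/-- The diagonal of a symmetric 3-cocycle is additive. -/
theorem diag_add_s10 (H : IsSymm3Cocycle h c) (x y : G) :
    c (x + y) (x + y) = c x x + c y y := by
  have hx := H.diag_add_diag x
  have hy := H.diag_add_diag y
  obtain ⟨-, hcoc, hhex, hanti⟩ := H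
  have hexpand := hhex (x + y) x y
  have hleft := hhex x x y
  have hright := hhex y x y
  have hcocycle := hcoc x y x y
  rw [add_comm y x] at hcocycle
  rw [hanti (x + y) x, hanti (x + y) y] at hexpand
  rw [hanti y x] at hright
  linear_combination (norm := abel) hexpand - hleft - hright + hcocycle - hx - hy

/-- The diagonal of a symmetric 3-cocycle, as an additive homomorphism. -/
def diagHom (H : IsSymm3Cocycle h c) : G →+ M :=
  AddMonoidHom.mk' (fun x => c x x) H.diag_add_s10

theorem diag_nsmul (H : IsSymm3Cocycle h c) (k : ℕ) (x : G) :
    c (k • x) (k • x) = k ^ 2 • c x x := by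
  have hlin : c (k • x) (k • x) = k • c x x := map_nsmul H.diagHom k x
  obtain ⟨m, hm⟩ : 2 ∣ k ^ 2 - k := by
    rw [sq, ← Nat.mul_sub_one]
    exact (Nat.even_mul_pred_self k).two_dvd
  have hsq : k ^ 2 = k + 2 * m := by
    have := Nat.le_self_pow two_ne_zero k
    omega
  rw [hlin, hsq, add_nsmul, mul_comm, mul_nsmul', two_nsmul, H.diag_add_diag, nsmul_zero,
    add_zero]

end IsSymm3Cocycle

/-- For a symmetric 3-cocycle `(h, c)` for `ℤ/n`, one has `c(x,x) = x̄² • c(1,1)`,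
where `x̄ ∈ {0, …, n-1}` is the canonical integer representative of `x`. -/
theorem stmt_10 (n : ℕ) (hn : 0 < n) (M : Type*) [AddCommGroup M]
    (h : ZMod n → ZMod n → ZMod n → M) (c : ZMod n → ZMod n → M)
    (hhc : IsSymm3Cocycle h c) :
    ∀ x : ZMod n, c x x = x.val ^ 2 • c 1 1 := by
  intro x
  have : NeZero n := ⟨hn.ne'⟩
  simpa using hhc.diag_nsmul x.val 1
end

section
/- Let n be a positive natural number, let M be an additive abelian group, and let τ ∈ M satisfy 2 • τ = 0 and n • τ = 0. For x ∈ ℤ/n let x̄ ∈ {0, …, n-1} denote its canonical integer representative, and define ρ : (ℤ/n) × (ℤ/n) → M by ρ(x,y) = (x̄ · ȳ) • τ. Then the pair (0, ρ) (with identically zero h) is a symmetric 3-cocycle for ℤ/n with coefficients in M. -/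
theorem mod_nsmul_of_nsmul_eq_zero {M : Type*} [AddCommGroup M] {n : ℕ} {τ : M}
    (h : n • τ = 0) (a : ℕ) : (a % n) • τ = a • τ := by
  conv_rhs => rw [← Nat.mod_add_div a n, add_nsmul, mul_nsmul, h, nsmul_zero, add_zero]

/-- For `τ ∈ M` with `2 • τ = 0` and `n • τ = 0`, the pair `(0, ρ)` with
`ρ(x,y) = (x̄ · ȳ) • τ` is a symmetric 3-cocycle for `ℤ/n`. -/
theorem stmt_11 (n : ℕ) (hn : 0 < n) (M : Type*) [AddCommGroup M]
    (τ : M) (hτ2 : 2 • τ = 0) (hτn : n • τ = 0) :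
    IsSymm3Cocycle (fun (_ _ _ : ZMod n) => (0 : M))
      (fun x y : ZMod n => (x.val * y.val) • τ) := by
  have : NeZero n := ⟨hn.ne'⟩
  refine ⟨fun _ _ => rfl, fun _ _ _ _ => by simp, fun x y z => ?_, fun x y => ?_⟩
  · simp only [zero_add, add_zero]
    rw [ZMod.val_add, mul_nsmul', mod_nsmul_of_nsmul_eq_zero hτn, ← mul_nsmul', mul_add,
      add_nsmul, add_comm]
  · beta_reduce
    rw [eq_neg_iff_add_eq_zero, mul_comm y.val, ← two_nsmul, smul_comm, hτ2, nsmul_zero]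
end

section
/- Let M be an additive abelian group and let τ ∈ M satisfy 2 • τ = 0. Define c : ℤ × ℤ → M by c(m,k) = (m·k) • τ. Then the pair (0, c) (with identically zero h) is a symmetric 3-cocycle for ℤ with coefficients in M. (Taking M = ℤ/2 and τ = 1 gives the cocycle underlying the Picard groupoid 𝕊 which models the Postnikov 1-truncation of the sphere spectrum: objects ℤ, automorphism group ℤ/2 at each object, and symmetry c(m,n) = mn mod 2.) -/
/-- For `τ ∈ M` with `2 • τ = 0`, the pair `(0, c)` with `c(m,k) = (m·k) • τ`
is a symmetric 3-cocycle for `ℤ`.  (With `M = ℤ/2` and `τ = 1` this is the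
cocycle underlying the Picard groupoid `𝕊` modeling the truncated sphere.) -/
theorem stmt_12 (M : Type*) [AddCommGroup M] (τ : M) (hτ2 : 2 • τ = 0) :
    IsSymm3Cocycle (fun (_ _ _ : ℤ) => (0 : M))
      (fun m k : ℤ => (m * k) • τ) := by
  refine ⟨fun _ _ => rfl, fun _ _ _ _ => by simp, fun x y z => ?_, fun x y => ?_⟩
  · simp only [mul_add, add_smul, zero_add, add_zero]
    exact add_comm _ _
  · have hneg : -τ = τ := neg_eq_of_add_eq_zero_left (by rwa [← two_nsmul])
    rw [← smul_neg, hneg, mul_comm]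
end

section
/- Let n be a positive natural number, let M be an additive abelian group, and let μ ∈ M satisfy n • μ = 0. For x ∈ ℤ/n let x̄ ∈ {0, …, n-1} denote its canonical integer representative, and define h_μ : (ℤ/n)³ → M by h_μ(x,y,z) = x̄ • μ if ȳ + z̄ ≥ n (addition over the integers), and h_μ(x,y,z) = 0 otherwise. Then h_μ is a normalized 3-cocycle: h_μ(x,0,z) = 0 for all x, z, and h_μ(x,y,z) + h_μ(u,x+y,z) + h_μ(u,x,y) = h_μ(u,x,y+z) + h_μ(u+x,y,z) for all u, x, y, z ∈ ℤ/n. -/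
/-- The representative of a sum drops by `n` exactly when a carry occurs. -/
theorem ZMod.val_add_add_ite {n : ℕ} [NeZero n] (a b : ZMod n) :
    (a + b).val + (if n ≤ a.val + b.val then n else 0) = a.val + b.val := by
  split_ifs with h
  · exact (ZMod.val_add_val_of_le h).symm
  · exact ZMod.val_add_of_lt (not_le.mp h)

/-- For `μ ∈ M` with `n • μ = 0`, the Joyal–Street function
`h_μ(x,y,z) = x̄ • μ` if `ȳ + z̄ ≥ n` and `0` otherwise (with `x̄` the canonical
integer representative of `x ∈ ℤ/n`) is a normalized 3-cocycle. -/
theorem stmt_13 (n : ℕ) (hn : 0 < n) (M : Type*) [AddCommGroup M]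
    (μ : M) (hμ : n • μ = 0)
    (hμfun : ZMod n → ZMod n → ZMod n → M)
    (hdef : ∀ x y z : ZMod n,
      hμfun x y z = if n ≤ y.val + z.val then x.val • μ else 0) :
    (∀ x z : ZMod n, hμfun x 0 z = 0) ∧
    (∀ u x y z : ZMod n,
      hμfun x y z + hμfun u (x + y) z + hμfun u x y =
        hμfun u x (y + z) + hμfun (u + x) y z) := by
  have : NeZero n := ⟨hn.ne'⟩
  refine ⟨fun x z => ?_, fun u x y z => ?_⟩
  · simp [hdef, (ZMod.val_lt z).not_ge]
  · have hadd : (u + x).val • μ = u.val • μ + x.val • μ := by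
      rw [← add_smul, ← ZMod.val_add_add_ite u x, add_smul]
      split_ifs <;> simp [hμ]
    have hxy := ZMod.val_add_add_ite x y
    have hyz := ZMod.val_add_add_ite y z
    have hxyz : (x + y + z).val = (x + (y + z)).val := by rw [add_assoc]
    have hl := ZMod.val_add_add_ite (x + y) z
    have hr := ZMod.val_add_add_ite x (y + z)
    simp only [hdef, hadd]
    split_ifs at * <;> first | omega | abel
end

section
/- Let C be a Picard groupoid and let x be an object of C. Then the endomorphisms of x commute under composition: for all morphisms f, g : x → x, f ≫ g = g ≫ f. -/
open CategoryTheory MonoidalCategory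

/-- The endomorphisms of the monoidal unit commute (Eckmann–Hilton). -/
theorem unit_end_comm {C : Type*} [Category C] [MonoidalCategory C]
    (f g : 𝟙_ C ⟶ 𝟙_ C) : f ≫ g = g ≫ f := by
  have hf : f = (ρ_ (𝟙_ C)).inv ≫ f ▷ 𝟙_ C ≫ (ρ_ (𝟙_ C)).hom := by simp
  have hg : g = (ρ_ (𝟙_ C)).inv ≫ 𝟙_ C ◁ g ≫ (ρ_ (𝟙_ C)).hom := by
    rw [← unitors_equal, leftUnitor_naturality, ← Category.assoc, unitors_equal]
    simp
  rw [hf, hg]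
  simp only [Category.assoc, Iso.hom_inv_id_assoc]
  rw [whisker_exchange_assoc]

/-- Tensoring on the left with `y` is faithful if `y` has a left inverse `z`. -/
theorem whiskerLeft_injective_of_iso_unit {C : Type*} [Category C] [MonoidalCategory C]
    {y z : C} (e : z ⊗ y ≅ 𝟙_ C) {a b : C} {f g : a ⟶ b} (h : y ◁ f = y ◁ g) : f = g := by
  have hzy : (z ⊗ y) ◁ f = (z ⊗ y) ◁ g := by simp only [tensor_whiskerLeft, h]
  have hu : 𝟙_ C ◁ f = 𝟙_ C ◁ g := by
    rw [← cancel_epi (e.hom ▷ a), ← whisker_exchange, ← whisker_exchange, hzy]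
  simpa using hu

/-- In a Picard groupoid (a symmetric monoidal groupoid in which every object
is invertible), the endomorphisms of any object commute under composition. -/
theorem stmt_15 (C : Type*) [Groupoid C] [MonoidalCategory C] [SymmetricCategory C]
    (hinv : ∀ x : C, ∃ y : C, Nonempty (y ⊗ x ≅ 𝟙_ C))
    (x : C) (f g : x ⟶ x) : f ≫ g = g ≫ f := by
  obtain ⟨y, ⟨e⟩⟩ := hinv x
  obtain ⟨z, ⟨e'⟩⟩ := hinv y
  apply whiskerLeft_injective_of_iso_unit e'
  have h := unit_end_comm (e.inv ≫ y ◁ f ≫ e.hom) (e.inv ≫ y ◁ g ≫ e.hom)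
  simp only [Category.assoc, Iso.hom_inv_id_assoc, cancel_epi] at h
  simp only [← Category.assoc, cancel_mono] at h
  simpa only [whiskerLeft_comp] using h
end
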